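/- arXiv:2509.09519 — 2 statements merged into one kernel-verified Lean document; each statement's English description precedes it below -/
import Mathlib

section
/- Let γ ∈ (−1, ∞) and ν ∈ (−2, ∞). Then there exists a finite constant C > 0, depending only on γ, ν and κ, such that w_{γ,ν}(S(x, 2r)) ≤ C · w_{γ,ν}(S(x, r)) for all x ∈ 𝒟 and all r > 0. -/
open MeasureTheory Set Real
open scoped ENNReal

noncomputable section

abbrev E2 := EuclideanSpace ℝ (Fin 2)

/-- The planar angular domain with opening angle `κ`. -/
def Dset (κ : ℝ) : Set E2 :=
  {x | ∃ r φ : ℝ, 0 < r ∧ 0 < φ ∧ φ < κ ∧ x 0 = r * Real.cos φ ∧ x 1 = r * Real.sin φ}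

/-- `B(x, r)`: the part of the Euclidean ball of radius `r` around `x` lying in `𝒟`. -/
def ballD (κ : ℝ) (x : E2) (r : ℝ) : Set E2 :=
  {y | y ∈ Dset κ ∧ dist y x < r}

/-- Geodesic (arc-length) distance between unit vectors of `S¹ ⊆ ℝ²`. -/
def dS1 (u v : E2) : ℝ := Real.arccos (inner ℝ u v)

/-- The "windshield wiper" set `S(x, r)`; for `x = 0` the angular condition is vacuous
(convention `a/0 = ∞`). -/
def Sset (κ : ℝ) (x : E2) (r : ℝ) : Set E2 :=
  {y | y ∈ Dset κ ∧ |‖y‖ - ‖x‖| < r ∧ (x ≠ 0 → dS1 (‖x‖⁻¹ • x) (‖y‖⁻¹ • y) < r / ‖x‖)}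

/-- Distance from `x` to the boundary of `𝒟`. -/
def rhoD (κ : ℝ) (x : E2) : ℝ := Metric.infDist x (frontier (Dset κ))

/-- The mixed power weight `w_{γ,ν}(x) = ρ_∘(x)^{ν-γ} ρ_𝒟(x)^γ`. -/
def wgt (κ γ ν : ℝ) (x : E2) : ℝ := ‖x‖ ^ (ν - γ) * rhoD κ x ^ γ

/-- `w_{γ,ν}(E) = ∫_E w_{γ,ν} dx`, valued in `[0,∞]`. -/
def wMeas (κ γ ν : ℝ) (E : Set E2) : ℝ≥0∞ :=
  ∫⁻ x in E, ENNReal.ofReal (wgt κ γ ν x)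

open scoped NNReal

theorem rpow_le_of_comparable {A x y : ℝ} (a : ℝ) (hA : 1 ≤ A) (hx : 0 < x) (hy : 0 < y)
    (hxy : x ≤ A * y) (hyx : y ≤ A * x) : x ^ a ≤ A ^ |a| * y ^ a := by
  have hA0 : 0 < A := by linarith
  rcases le_total 0 a with ha | ha
  · rw [abs_of_nonneg ha, ← Real.mul_rpow hA0.le hy.le]
    exact Real.rpow_le_rpow hx.le hxy ha
  · have h : (A * x) ^ a ≤ y ^ a := Real.rpow_le_rpow_of_nonpos hy hyx ha
    rw [Real.mul_rpow hA0.le hx.le] at h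
    calc x ^ a = A ^ |a| * (A ^ a * x ^ a) := by
          rw [← mul_assoc, ← Real.rpow_add hA0, abs_of_nonpos ha]; simp
      _ ≤ _ := by gcongr

theorem lintegral_rpow_Ioc {a b : ℝ} (ha : -1 < a) (hb : 0 ≤ b) :
    ∫⁻ s in Ioc 0 b, ENNReal.ofReal (s ^ a) = ENNReal.ofReal (b ^ (a + 1) / (a + 1)) := by
  have hi := (intervalIntegral.intervalIntegrable_rpow' (a := 0) (b := b) ha).1
  rw [← ofReal_integral_eq_lintegral_ofReal hi]
  · rw [← intervalIntegral.integral_of_le hb, integral_rpow (Or.inl ha),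
      Real.zero_rpow (by linarith), sub_zero]
  · filter_upwards [ae_restrict_mem measurableSet_Ioc] with s hs
    exact Real.rpow_nonneg hs.1.le _

theorem ofReal_mul_le_setLIntegral {f : ℝ → ℝ} {u v c : ℝ} {S : Set ℝ}
    (hS : Ioo u v ⊆ S) (huv : u ≤ v) (h : ∀ s ∈ Ioo u v, c ≤ f s) :
    ENNReal.ofReal ((v - u) * c) ≤ ∫⁻ s in S, ENNReal.ofReal (f s) := by
  calc ENNReal.ofReal ((v - u) * c) = ∫⁻ s in Ioo u v, ENNReal.ofReal c := by
        rw [setLIntegral_const, Real.volume_Ioo, mul_comm, ENNReal.ofReal_mul' (by linarith)]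
    _ ≤ ∫⁻ s in Ioo u v, ENNReal.ofReal (f s) :=
        setLIntegral_mono' measurableSet_Ioo fun s hs => ENNReal.ofReal_le_ofReal (h s hs)
    _ ≤ _ := lintegral_mono_set hS

theorem setLIntegral_rpow_doubling {a : ℝ} (ha : -1 < a) :
    ∃ C : ℝ≥0, ∀ L t R : ℝ, 0 < t → t ≤ L → 0 < R →
      ∫⁻ s in Ioo (t - 2 * R) (t + 2 * R) ∩ Ioc 0 L, ENNReal.ofReal (s ^ a) ≤
        C * ∫⁻ s in Ioo (t - R) (t + R) ∩ Ioc 0 L, ENNReal.ofReal (s ^ a) := by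
  have ha1 : 0 < a + 1 := by linarith
  set C₁ : ℝ := 4 * (2 ^ |a| * 2 ^ |a|) with hC₁
  set C₂ : ℝ := 4 * (4 ^ |a| * (6 ^ (a + 1) / (a + 1))) with hC₂
  have hC₁0 : 0 ≤ C₁ := by positivity
  have hC₂0 : 0 ≤ C₂ := by positivity
  have key : ∀ (C : ℝ) (X Y : ℝ≥0∞) (x y : ℝ), 0 ≤ C → C ≤ 1 + C₁ + C₂ →
      X ≤ ENNReal.ofReal x → ENNReal.ofReal y ≤ Y → x ≤ C * y →
      X ≤ ((1 + C₁ + C₂).toNNReal : ℝ≥0∞) * Y := by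
    intro C X Y x y hC hCC hX hY hxy
    calc X ≤ ENNReal.ofReal (C * y) := hX.trans (ENNReal.ofReal_le_ofReal hxy)
      _ = ENNReal.ofReal C * ENNReal.ofReal y := ENNReal.ofReal_mul hC
      _ ≤ _ := mul_le_mul' (ENNReal.ofReal_le_ofReal hCC) hY
  refine ⟨(1 + C₁ + C₂).toNNReal, fun L t R ht htL hR => ?_⟩
  rcases le_or_gt L R with hLR | hRL
  · have h1 : (1 : ℝ≥0∞) ≤ ((1 + C₁ + C₂).toNNReal : ℝ≥0∞) := by
      rw [← ENNReal.ofReal_one]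
      exact ENNReal.ofReal_le_ofReal (by linarith)
    refine le_trans (lintegral_mono_set ?_) (le_mul_of_one_le_left' h1)
    rintro s ⟨-, hs⟩
    exact ⟨⟨by linarith [hs.1], by linarith [hs.2]⟩, hs⟩
  rcases le_or_gt (4 * R) t with htR | htR
  · refine key C₁ _ _ ((4 * R) * (2 ^ |a| * t ^ a)) ((t - (t - R)) * ((2 ^ |a|)⁻¹ * t ^ a))
      hC₁0 (by linarith) ?_ (ofReal_mul_le_setLIntegral ?_ (by linarith) ?_) ?_
    · calc _ ≤ ∫⁻ s in Ioo (t - 2 * R) (t + 2 * R), ENNReal.ofReal (s ^ a) :=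
            lintegral_mono_set inter_subset_left
        _ ≤ ∫⁻ s in Ioo (t - 2 * R) (t + 2 * R), ENNReal.ofReal (2 ^ |a| * t ^ a) :=
            setLIntegral_mono' measurableSet_Ioo fun s hs => ENNReal.ofReal_le_ofReal <|
              rpow_le_of_comparable a (by norm_num) (by linarith [hs.1]) ht
                (by linarith [hs.2]) (by linarith [hs.1])
        _ = _ := by
            rw [setLIntegral_const, Real.volume_Ioo, mul_comm, ← ENNReal.ofReal_mul (by linarith)]
            congr 1; ring
    · rintro s ⟨h1, h2⟩
      exact ⟨⟨h1, by linarith⟩, by linarith, by linarith⟩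
    · rintro s ⟨h1, h2⟩
      rw [inv_mul_le_iff₀ (by positivity)]
      exact rpow_le_of_comparable a (by norm_num) ht (by linarith) (by linarith) (by linarith)
    · apply le_of_eq
      rw [hC₁]
      field_simp
      ring
  · have hlow : ENNReal.ofReal (R / 4 * ((4 ^ |a|)⁻¹ * R ^ a)) ≤
        ∫⁻ s in Ioo (t - R) (t + R) ∩ Ioc 0 L, ENNReal.ofReal (s ^ a) := by
      rcases le_or_gt (R / 2) t with h | h
      · have := ofReal_mul_le_setLIntegral (f := fun s => s ^ a) (u := t - R / 4) (v := t)
          (c := (4 ^ |a|)⁻¹ * R ^ a) (S := Ioo (t - R) (t + R) ∩ Ioc 0 L) ?_ (by linarith) ?_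
        · rwa [sub_sub_cancel] at this
        · rintro s ⟨h1, h2⟩
          exact ⟨⟨by linarith, by linarith⟩, by linarith, by linarith⟩
        · rintro s ⟨h1, h2⟩
          rw [inv_mul_le_iff₀ (by positivity)]
          exact rpow_le_of_comparable a (by norm_num) hR (by linarith) (by linarith) (by linarith)
      · have := ofReal_mul_le_setLIntegral (f := fun s => s ^ a) (u := R / 2) (v := R / 2 + R / 4)
          (c := (4 ^ |a|)⁻¹ * R ^ a) (S := Ioo (t - R) (t + R) ∩ Ioc 0 L) ?_ (by linarith) ?_
        · rwa [add_sub_cancel_left] at this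
        · rintro s ⟨h1, h2⟩
          exact ⟨⟨by linarith, by linarith⟩, by linarith, by linarith⟩
        · rintro s ⟨h1, h2⟩
          rw [inv_mul_le_iff₀ (by positivity)]
          exact rpow_le_of_comparable a (by norm_num) hR (by linarith) (by linarith) (by linarith)
    refine key C₂ _ _ _ _ hC₂0 (by linarith) (le_trans (lintegral_mono_set ?_)
      (lintegral_rpow_Ioc ha (b := 6 * R) (by positivity)).le) hlow ?_
    · rintro s ⟨⟨h1, h2⟩, h3, h4⟩
      exact ⟨h3, by linarith⟩
    · apply le_of_eq
      rw [hC₂, Real.mul_rpow (by norm_num) hR.le, Real.rpow_add hR, Real.rpow_one]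
      field_simp

/-- The distance from `φ` to the endpoints of `(0, κ)`. -/
def endDist (κ φ : ℝ) : ℝ := min φ (κ - φ)

theorem endDist_sub (κ φ : ℝ) : endDist κ (κ - φ) = endDist κ φ := by
  simp [endDist, min_comm]

theorem setLIntegral_comp_sub_left (κ : ℝ) (f : ℝ → ℝ≥0∞) (S : Set ℝ) :
    ∫⁻ x in (fun x => κ - x) ⁻¹' S, f (κ - x) = ∫⁻ x in S, f x :=
  (Measure.measurePreserving_sub_left volume κ).setLIntegral_comp_preimage_emb
    (MeasurableEquiv.subLeft κ).measurableEmbedding f S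

theorem setLIntegral_endDist_doubling {γ κ : ℝ} (hγ : -1 < γ) (hκ : 0 < κ) :
    ∃ C : ℝ≥0, ∀ θ ∈ Ioo 0 κ, ∀ δ : ℝ, 0 < δ →
      ∫⁻ φ in Ioo (θ - 2 * δ) (θ + 2 * δ) ∩ Ioo 0 κ, ENNReal.ofReal (endDist κ φ ^ γ) ≤
        C * ∫⁻ φ in Ioo (θ - δ) (θ + δ) ∩ Ioo 0 κ, ENNReal.ofReal (endDist κ φ ^ γ) := by
  obtain ⟨C, hC⟩ := setLIntegral_rpow_doubling hγ
  set f : ℝ → ℝ≥0∞ := fun φ => ENNReal.ofReal (endDist κ φ ^ γ) with hf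
  have hfs : ∀ φ, f (κ - φ) = f φ := fun φ => by simp [hf, endDist_sub]
  have main : ∀ θ ∈ Ioc 0 (κ / 2), ∀ δ : ℝ, 0 < δ →
      ∫⁻ φ in Ioo (θ - 2 * δ) (θ + 2 * δ) ∩ Ioo 0 κ, f φ ≤
        (2 * C : ℝ≥0) * ∫⁻ φ in Ioo (θ - δ) (θ + δ) ∩ Ioo 0 κ, f φ := by
    intro θ hθ δ hδ
    set T := Ioo (θ - 2 * δ) (θ + 2 * δ) ∩ Ioc 0 (κ / 2) with hT
    have hsub : Ioo (θ - 2 * δ) (θ + 2 * δ) ∩ Ioo 0 κ ⊆ T ∪ (fun x => κ - x) ⁻¹' T := by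
      rintro φ ⟨⟨h1, h2⟩, h3, h4⟩
      rcases le_total φ (κ / 2) with h | h
      · exact Or.inl ⟨⟨h1, h2⟩, h3, h⟩
      · refine Or.inr ⟨⟨?_, ?_⟩, ?_, ?_⟩ <;> simp only <;> linarith [hθ.1, hθ.2]
    have hhalf : ∀ δ' : ℝ, ∫⁻ φ in Ioo (θ - δ') (θ + δ') ∩ Ioc 0 (κ / 2), f φ =
        ∫⁻ φ in Ioo (θ - δ') (θ + δ') ∩ Ioc 0 (κ / 2), ENNReal.ofReal (φ ^ γ) := fun δ' => by
      refine setLIntegral_congr_fun (measurableSet_Ioo.inter measurableSet_Ioc) fun φ hφ => ?_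
      have : endDist κ φ = φ := min_eq_left (by linarith [hφ.2.2])
      simp only [hf, this]
    have hrefl : ∫⁻ φ in (fun x => κ - x) ⁻¹' T, f φ = ∫⁻ φ in T, f φ := by
      rw [← setLIntegral_comp_sub_left κ f T]
      simp only [hfs]
    calc _ ≤ ∫⁻ φ in T ∪ (fun x => κ - x) ⁻¹' T, f φ := lintegral_mono_set hsub
      _ ≤ (∫⁻ φ in T, f φ) + ∫⁻ φ in (fun x => κ - x) ⁻¹' T, f φ := lintegral_union_le _ _ _
      _ = 2 * ∫⁻ φ in T, f φ := by rw [hrefl, two_mul]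
      _ ≤ 2 * (C * ∫⁻ φ in Ioo (θ - δ) (θ + δ) ∩ Ioc 0 (κ / 2), f φ) := by
          rw [hT, hhalf, hhalf]
          gcongr
          exact hC _ _ _ hθ.1 hθ.2 hδ
      _ ≤ 2 * (C * ∫⁻ φ in Ioo (θ - δ) (θ + δ) ∩ Ioo 0 κ, f φ) := by
          gcongr
          linarith
      _ = _ := by push_cast; ring
  refine ⟨2 * C, fun θ hθ δ hδ => ?_⟩
  rcases le_total θ (κ / 2) with h | h
  · exact main θ ⟨hθ.1, h⟩ δ hδ
  · have hset : ∀ δ' : ℝ, ∫⁻ φ in Ioo (κ - θ - δ') (κ - θ + δ') ∩ Ioo 0 κ, f φ =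
        ∫⁻ φ in Ioo (θ - δ') (θ + δ') ∩ Ioo 0 κ, f φ := fun δ' => by
      rw [← setLIntegral_comp_sub_left κ f]
      simp only [hfs]
      congr 2
      ext φ
      simp only [mem_preimage, mem_inter_iff, mem_Ioo]
      constructor <;> rintro ⟨⟨_, _⟩, _, _⟩ <;> refine ⟨⟨?_, ?_⟩, ?_, ?_⟩ <;> linarith
    have := main (κ - θ) ⟨by linarith [hθ.2], by linarith⟩ δ hδ
    rwa [hset, hset] at this

theorem arccos_cos_le_abs (x : ℝ) : arccos (cos x) ≤ |x| := by
  rcases le_total |x| π with h | h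
  · rw [← Real.cos_abs, Real.arccos_cos (abs_nonneg x) h]
  · exact (Real.arccos_le_pi _).trans h

theorem abs_lt_of_arccos_cos_lt {x δ κ : ℝ} (hx : |x| < κ) (hκ : κ < 2 * π)
    (hδ : δ ≤ 2 * π - κ) (h : arccos (cos x) < δ) : |x| < δ := by
  rcases le_total |x| π with h' | h'
  · rwa [← Real.cos_abs, Real.arccos_cos (abs_nonneg x) h'] at h
  · rw [← Real.cos_abs, ← Real.cos_two_pi_sub,
      Real.arccos_cos (by linarith) (by linarith)] at h
    linarith

/-- The angles in `(0, κ)` at circle distance less than `δ` from `θ`. -/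
def arcSet (κ θ δ : ℝ) : Set ℝ := {φ ∈ Ioo 0 κ | arccos (cos (φ - θ)) < δ}

theorem measurableSet_arcSet (κ θ δ : ℝ) : MeasurableSet (arcSet κ θ δ) :=
  measurableSet_Ioo.inter (measurableSet_lt
    (Real.continuous_arccos.comp (Real.continuous_cos.comp
      (continuous_id.sub continuous_const))).measurable measurable_const)

theorem Ioo_inter_subset_arcSet (κ θ δ : ℝ) :
    Ioo (θ - δ) (θ + δ) ∩ Ioo 0 κ ⊆ arcSet κ θ δ := by
  rintro φ ⟨⟨h1, h2⟩, h3⟩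
  exact ⟨h3, (arccos_cos_le_abs _).trans_lt (abs_lt.2 ⟨by linarith, by linarith⟩)⟩

theorem setLIntegral_arcSet_doubling {γ κ : ℝ} (hγ : -1 < γ) (hκ : 0 < κ) (hκ' : κ < 2 * π) :
    ∃ C : ℝ≥0, ∀ θ ∈ Ioo 0 κ, ∀ δ : ℝ, 0 < δ →
      ∫⁻ φ in arcSet κ θ (2 * δ), ENNReal.ofReal (endDist κ φ ^ γ) ≤
        C * ∫⁻ φ in arcSet κ θ δ, ENNReal.ofReal (endDist κ φ ^ γ) := by
  obtain ⟨C, hC⟩ := setLIntegral_endDist_doubling hγ hκ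
  set δ₀ : ℝ := (2 * π - κ) / 2 with hδ₀
  have hδ₀0 : 0 < δ₀ := by rw [hδ₀]; linarith
  obtain ⟨N, hN⟩ := pow_unbounded_of_one_lt (κ / δ₀) one_lt_two
  rw [div_lt_iff₀ hδ₀0] at hN
  refine ⟨C + C ^ N, fun θ hθ δ hδ => ?_⟩
  rw [ENNReal.coe_add, add_mul]
  rcases le_or_gt δ δ₀ with h | h
  · refine le_trans ?_ le_self_add
    calc _ ≤ ∫⁻ φ in Ioo (θ - 2 * δ) (θ + 2 * δ) ∩ Ioo 0 κ,
          ENNReal.ofReal (endDist κ φ ^ γ) := by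
          refine lintegral_mono_set ?_
          rintro φ ⟨h1, h2⟩
          have := abs_lt.1 (abs_lt_of_arccos_cos_lt (κ := κ) (abs_lt.2
            ⟨by linarith [h1.1, hθ.2], by linarith [h1.2, hθ.1]⟩) hκ' (by linarith) h2)
          exact ⟨⟨by linarith, by linarith⟩, h1⟩
      _ ≤ _ := hC θ hθ δ hδ
      _ ≤ _ := by
          gcongr
          exact Ioo_inter_subset_arcSet _ _ _
  · refine le_trans ?_ le_add_self
    have iter : ∀ n : ℕ, ∫⁻ φ in Ioo (θ - 2 ^ n * δ₀) (θ + 2 ^ n * δ₀) ∩ Ioo 0 κ,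
        ENNReal.ofReal (endDist κ φ ^ γ) ≤ (C ^ n : ℝ≥0) *
          ∫⁻ φ in Ioo (θ - δ₀) (θ + δ₀) ∩ Ioo 0 κ, ENNReal.ofReal (endDist κ φ ^ γ) := by
      intro n
      induction n with
      | zero => simp
      | succ n ih =>
        have := hC θ hθ (2 ^ n * δ₀) (by positivity)
        rw [← mul_assoc, ← pow_succ'] at this
        refine this.trans ?_
        rw [pow_succ', ENNReal.coe_mul, mul_assoc]
        gcongr
    calc _ ≤ ∫⁻ φ in Ioo (θ - 2 ^ N * δ₀) (θ + 2 ^ N * δ₀) ∩ Ioo 0 κ,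
          ENNReal.ofReal (endDist κ φ ^ γ) := by
          refine lintegral_mono_set ?_
          rintro φ ⟨h1, -⟩
          exact ⟨⟨by linarith [h1.1, hθ.2], by linarith [h1.2, hθ.1]⟩, h1⟩
      _ ≤ _ := iter N
      _ ≤ _ := by
          gcongr
          refine subset_trans ?_ (Ioo_inter_subset_arcSet _ _ _)
          exact inter_subset_inter_left _ (Ioo_subset_Ioo (by linarith) (by linarith))

/-- The positive radii within distance `R` of `t`. -/
def radSet (t R : ℝ) : Set ℝ := {s | 0 < s ∧ |s - t| < R}

theorem measurableSet_radSet (t R : ℝ) : MeasurableSet (radSet t R) :=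
  measurableSet_Ioi.inter (measurableSet_lt
    (continuous_abs.comp (continuous_id.sub continuous_const)).measurable measurable_const)

theorem setLIntegral_radSet_doubling {a : ℝ} (ha : -1 < a) :
    ∃ C : ℝ≥0, ∀ t R : ℝ, 0 < t → 0 < R →
      ∫⁻ s in radSet t (2 * R), ENNReal.ofReal (s ^ a) ≤
        C * ∫⁻ s in radSet t R, ENNReal.ofReal (s ^ a) := by
  obtain ⟨C, hC⟩ := setLIntegral_rpow_doubling ha
  refine ⟨C, fun t R ht hR => ?_⟩
  have hset : ∀ R' ≤ 2 * R, radSet t R' = Ioo (t - R') (t + R') ∩ Ioc 0 (t + 2 * R) := by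
    intro R' hR'
    ext s
    simp only [radSet, mem_ofPred_eq, abs_lt, mem_inter_iff, mem_Ioo, mem_Ioc]
    constructor
    · rintro ⟨h1, h2, h3⟩
      exact ⟨⟨by linarith, by linarith⟩, h1, by linarith⟩
    · rintro ⟨⟨h1, h2⟩, h3, h4⟩
      exact ⟨h3, by linarith, by linarith⟩
  rw [hset _ le_rfl, hset R (by linarith)]
  exact hC _ _ _ ht (by linarith) hR

/-- The point of the plane with polar coordinates `(s, φ)`. -/
def polarPt (s φ : ℝ) : E2 := !₂[s * cos φ, s * sin φ]

theorem norm_polarPt {s : ℝ} (hs : 0 ≤ s) (φ : ℝ) : ‖polarPt s φ‖ = s := by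
  rw [EuclideanSpace.norm_eq, Fin.sum_univ_two]
  simp only [polarPt, Real.norm_eq_abs, sq_abs, PiLp.toLp_apply, Matrix.cons_val_zero,
    Matrix.cons_val_one]
  rw [mul_pow, mul_pow, ← mul_add, Real.cos_sq_add_sin_sq, mul_one, Real.sqrt_sq hs]

theorem mem_Dset_iff {κ : ℝ} {x : E2} :
    x ∈ Dset κ ↔ ∃ s φ : ℝ, 0 < s ∧ φ ∈ Ioo 0 κ ∧ x = polarPt s φ := by
  constructor
  · rintro ⟨s, φ, hs, h1, h2, h3, h4⟩
    refine ⟨s, φ, hs, ⟨h1, h2⟩, ?_⟩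
    ext i
    fin_cases i
    · simpa [polarPt] using h3
    · simpa [polarPt] using h4
  · rintro ⟨s, φ, hs, ⟨h1, h2⟩, rfl⟩
    exact ⟨s, φ, hs, h1, h2, by simp [polarPt], by simp [polarPt]⟩

theorem polarPt_ext_iff {s t φ θ : ℝ} :
    polarPt s φ = polarPt t θ ↔ s * cos φ = t * cos θ ∧ s * sin φ = t * sin θ := by
  constructor
  · intro h
    have h0 := congrArg (fun x : E2 => x 0) h
    have h1 := congrArg (fun x : E2 => x 1) h
    simp only [polarPt, PiLp.toLp_apply, Matrix.cons_val_zero, Matrix.cons_val_one] at h0 h1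
    exact ⟨h0, h1⟩
  · rintro ⟨h0, h1⟩
    simp only [polarPt, h0, h1]

theorem polarPt_inj {s t φ θ : ℝ} (hs : 0 < s) (ht : 0 < t) (h : polarPt s φ = polarPt t θ)
    (hd : |φ - θ| < 2 * π) : s = t ∧ φ = θ := by
  have hst : s = t := by rw [← norm_polarPt hs.le φ, h, norm_polarPt ht.le]
  subst hst
  obtain ⟨h0, h1⟩ := polarPt_ext_iff.1 h
  have hc := mul_left_cancel₀ hs.ne' h0
  have hsn := mul_left_cancel₀ hs.ne' h1
  have hone : cos (φ - θ) = 1 := by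
    rw [Real.cos_sub, hc, hsn]; nlinarith [Real.sin_sq_add_cos_sq θ]
  obtain ⟨h2, h3⟩ := abs_lt.1 hd
  exact ⟨rfl, sub_eq_zero.1 ((Real.cos_eq_one_iff_of_lt_of_lt h2 h3).1 hone)⟩

theorem dist_polarPt_le {s : ℝ} (hs : 0 ≤ s) (φ θ : ℝ) :
    dist (polarPt s φ) (polarPt s θ) ≤ s * |φ - θ| := by
  rw [EuclideanSpace.dist_eq, Fin.sum_univ_two]
  refine Real.sqrt_le_iff.2 ⟨by positivity, ?_⟩
  simp only [polarPt, Real.dist_eq, sq_abs, PiLp.toLp_apply, Matrix.cons_val_zero,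
    Matrix.cons_val_one]
  have h := Real.one_sub_sq_div_two_le_cos (x := φ - θ)
  rw [Real.cos_sub] at h
  rw [mul_pow, sq_abs]
  have e : (s * cos φ - s * cos θ) ^ 2 + (s * sin φ - s * sin θ) ^ 2 =
      s ^ 2 * (2 - 2 * (cos φ * cos θ + sin φ * sin θ)) := by
    linear_combination s ^ 2 * (Real.sin_sq_add_cos_sq φ + Real.sin_sq_add_cos_sq θ)
  rw [e]
  gcongr
  linarith

theorem continuous_polarPt (s : ℝ) : Continuous (polarPt s) := by
  unfold polarPt
  refine (PiLp.continuous_toLp 2 _).comp (continuous_pi fun i => ?_)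
  fin_cases i <;> simp <;> fun_prop

theorem polarPt_mem_frontier {κ s θ : ℝ} (hκ : 0 < κ) (hκ' : κ < 2 * π) (hs : 0 < s)
    (hθ : θ = 0 ∨ θ = κ) : polarPt s θ ∈ frontier (Dset κ) := by
  have hθmem : θ ∈ Icc 0 κ := by rcases hθ with rfl | rfl <;> simp [hκ.le]
  refine ⟨?_, fun hint => ?_⟩
  · have hcl : θ ∈ closure (Ioo 0 κ) := by rwa [closure_Ioo hκ.ne]
    exact map_mem_closure (continuous_polarPt s) hcl
      fun φ hφ => mem_Dset_iff.2 ⟨s, φ, hs, hφ, rfl⟩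
  · obtain ⟨t, φ, ht, hφ, h⟩ := mem_Dset_iff.1 (interior_subset hint)
    have := (polarPt_inj hs ht h (abs_lt.2 ⟨by linarith [hφ.2, hθmem.1],
      by linarith [hφ.1, hθmem.2]⟩)).2
    rcases hθ with rfl | rfl
    · linarith [hφ.1]
    · linarith [hφ.2]

theorem rhoD_polarPt_le {κ s φ : ℝ} (hκ' : κ < 2 * π) (hs : 0 < s)
    (hφ : φ ∈ Ioo 0 κ) : rhoD κ (polarPt s φ) ≤ s * endDist κ φ := by
  have hκ : 0 < κ := hφ.1.trans hφ.2
  have hle : ∀ θ, θ = 0 ∨ θ = κ → rhoD κ (polarPt s φ) ≤ s * |φ - θ| := fun θ hθ =>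
    (Metric.infDist_le_dist_of_mem (polarPt_mem_frontier hκ hκ' hs hθ)).trans
      (dist_polarPt_le hs.le φ θ)
  have h0 := hle 0 (Or.inl rfl)
  have h1 := hle κ (Or.inr rfl)
  rw [sub_zero, abs_of_pos hφ.1] at h0
  rw [abs_sub_comm, abs_of_pos (sub_pos.2 hφ.2)] at h1
  rcases min_cases φ (κ - φ) with ⟨h, -⟩ | ⟨h, -⟩ <;> rw [endDist, h] <;> assumption

theorem mem_Dset_of_dist_lt {κ s φ : ℝ} (hκ' : κ < 2 * π) (hs : 0 < s)
    {z : E2} (hz : dist (polarPt s φ) z < s * endDist κ φ / (2 * π)) : z ∈ Dset κ := by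
  have hm1 : endDist κ φ ≤ φ := min_le_left _ _
  have hm2 : endDist κ φ ≤ κ - φ := min_le_right _ _
  set Z : ℂ := ⟨z 0, z 1⟩ with hZ
  set W : ℂ := (s : ℂ) * Complex.exp (φ * Complex.I) with hW
  have hWn : ‖W‖ = s := by
    rw [hW, norm_mul, Complex.norm_exp_ofReal_mul_I, mul_one, Complex.norm_real, Real.norm_eq_abs,
      abs_of_pos hs]
  have hW0 : W ≠ 0 := by rw [← norm_ne_zero_iff, hWn]; exact hs.ne'
  have hWre : W.re = s * cos φ := by rw [hW, Complex.re_ofReal_mul, Complex.exp_ofReal_mul_I_re]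
  have hWim : W.im = s * sin φ := by rw [hW, Complex.im_ofReal_mul, Complex.exp_ofReal_mul_I_im]
  have hdist : ‖Z - W‖ = dist (polarPt s φ) z := by
    rw [EuclideanSpace.dist_eq, Fin.sum_univ_two, Complex.norm_eq_sqrt_sq_add_sq]
    simp only [polarPt, Real.dist_eq, sq_abs, PiLp.toLp_apply, Matrix.cons_val_zero,
      Matrix.cons_val_one, Complex.sub_re, Complex.sub_im, hWre, hWim, hZ]
    congr 1
    ring
  set ζ : ℂ := (Z - W) / W with hζ
  have hζn : ‖ζ‖ * (2 * π) < endDist κ φ := by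
    rw [hζ, norm_div, hWn, hdist, div_mul_eq_mul_div, div_lt_iff₀ hs]
    rw [lt_div_iff₀ (by positivity)] at hz
    linarith
  have hπ := Real.pi_gt_three
  have hζhalf : ‖ζ‖ ≤ 1 / 2 := by
    by_contra hcon
    nlinarith
  have hlog := Complex.norm_log_one_add_half_le_self hζhalf
  have harg : |(1 + ζ).arg| ≤ 3 / 2 * ‖ζ‖ := by
    rw [← Complex.log_im]
    exact (Complex.abs_im_le_norm _).trans hlog
  have hargm : |(1 + ζ).arg| < endDist κ φ := by
    nlinarith [norm_nonneg ζ]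
  have hne : 1 + ζ ≠ 0 := by
    intro h
    have : ζ = -1 := by linear_combination h
    rw [this, norm_neg, norm_one] at hζhalf
    norm_num at hζhalf
  have hZeq : Z = ((s * ‖1 + ζ‖ : ℝ) : ℂ) * Complex.exp ((φ + (1 + ζ).arg : ℝ) * Complex.I) := by
    have h1 : Z = W * (1 + ζ) := by rw [hζ]; field_simp; ring
    rw [h1]
    conv_lhs => rw [← Complex.norm_mul_exp_arg_mul_I (1 + ζ)]
    rw [hW, Complex.ofReal_add, add_mul, Complex.exp_add, Complex.ofReal_mul]
    ring
  obtain ⟨ha, hb⟩ := abs_lt.1 hargm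
  refine ⟨s * ‖1 + ζ‖, φ + (1 + ζ).arg, mul_pos hs (norm_pos_iff.2 hne), by linarith,
    by linarith, ?_, ?_⟩
  · have := congrArg Complex.re hZeq
    rwa [Complex.re_ofReal_mul, Complex.exp_ofReal_mul_I_re] at this
  · have := congrArg Complex.im hZeq
    rwa [Complex.im_ofReal_mul, Complex.exp_ofReal_mul_I_im] at this

theorem le_rhoD_polarPt {κ s φ : ℝ} (hκ' : κ < 2 * π) (hs : 0 < s)
    (hφ : φ ∈ Ioo 0 κ) : s * endDist κ φ / (2 * π) ≤ rhoD κ (polarPt s φ) := by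
  have hne : (frontier (Dset κ)).Nonempty :=
    ⟨_, polarPt_mem_frontier (hφ.1.trans hφ.2) hκ' hs (Or.inl rfl)⟩
  refine (Metric.le_infDist hne).2 fun y hy => ?_
  by_contra! hlt
  refine hy.2 (mem_interior.2 ⟨Metric.ball (polarPt s φ) (s * endDist κ φ / (2 * π)),
    fun z hz => ?_, Metric.isOpen_ball, ?_⟩)
  · exact mem_Dset_of_dist_lt hκ' hs (by rwa [dist_comm])
  · rwa [Metric.mem_ball, dist_comm]

theorem polarPt_mem_Sset_iff {κ t θ s φ R : ℝ} (ht : 0 < t) (hs : 0 < s) (hφ : φ ∈ Ioo 0 κ) :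
    polarPt s φ ∈ Sset κ (polarPt t θ) R ↔ s ∈ radSet t R ∧ φ ∈ arcSet κ θ (R / t) := by
  have hx : polarPt t θ ≠ 0 := by rw [← norm_ne_zero_iff, norm_polarPt ht.le]; exact ht.ne'
  have hD : polarPt s φ ∈ Dset κ := mem_Dset_iff.2 ⟨s, φ, hs, hφ, rfl⟩
  have hdS : dS1 (t⁻¹ • polarPt t θ) (s⁻¹ • polarPt s φ) = arccos (cos (φ - θ)) := by
    unfold dS1
    congr 1
    rw [Real.cos_sub]
    simp [polarPt, inner, Fin.sum_univ_two]
    field_simp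
  simp only [Sset, mem_ofPred_eq, norm_polarPt ht.le, norm_polarPt hs.le, hdS, radSet, arcSet]
  tauto

theorem Sset_eq_image {κ t θ R : ℝ} (ht : 0 < t) :
    Sset κ (polarPt t θ) R =
      (fun p : ℝ × ℝ => polarPt p.1 p.2) '' (radSet t R ×ˢ arcSet κ θ (R / t)) := by
  ext y
  constructor
  · intro hy
    obtain ⟨s, φ, hs, hφ, rfl⟩ := mem_Dset_iff.1 hy.1
    exact ⟨(s, φ), (polarPt_mem_Sset_iff ht hs hφ).1 hy, rfl⟩
  · rintro ⟨⟨s, φ⟩, ⟨h1, h2⟩, rfl⟩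
    exact (polarPt_mem_Sset_iff ht h1.1 h2.1).2 ⟨h1, h2⟩

theorem setLIntegral_image_polarPt {κ : ℝ} (hκ' : κ < 2 * π) {A : Set (ℝ × ℝ)}
    (hA : MeasurableSet A) (hAs : A ⊆ Ioi 0 ×ˢ Ioo 0 κ) (f : E2 → ℝ≥0∞) :
    ∫⁻ y in (fun p : ℝ × ℝ => polarPt p.1 p.2) '' A, f y =
      ∫⁻ p in A, ENNReal.ofReal p.1 * f (polarPt p.1 p.2) := by
  have hmp : MeasurePreserving
      ((MeasurableEquiv.toLp 2 (Fin 2 → ℝ)).symm.trans MeasurableEquiv.finTwoArrow).symm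
      (volume : Measure (ℝ × ℝ)) (volume : Measure E2) :=
    ((EuclideanSpace.volume_preserving_symm_measurableEquiv_toLp (Fin 2)).trans
      (volume_preserving_finTwoArrow ℝ)).symm _
  set e := ((MeasurableEquiv.toLp 2 (Fin 2 → ℝ)).symm.trans
    (MeasurableEquiv.finTwoArrow (α := ℝ))).symm with he
  have hpt : ∀ p : ℝ × ℝ, polarPt p.1 p.2 = e (polarCoord.symm p) := fun p => rfl
  have hinj : InjOn polarCoord.symm A := by
    intro p hp q hq hpq
    have h1 := hAs hp
    have h2 := hAs hq
    have := polarPt_inj h1.1 h2.1 (by rw [hpt, hpt, hpq] : polarPt p.1 p.2 = polarPt q.1 q.2)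
      (abs_lt.2 ⟨by linarith [h1.2.1, h2.2.2], by linarith [h1.2.2, h2.2.1]⟩)
    exact Prod.ext this.1 this.2
  have himg : (fun p : ℝ × ℝ => polarPt p.1 p.2) '' A = e '' (polarCoord.symm '' A) := by
    rw [image_image]; rfl
  rw [himg, ← hmp.setLIntegral_comp_preimage_emb e.measurableEmbedding,
    preimage_image_eq _ e.injective,
    lintegral_image_eq_lintegral_abs_det_fderiv_mul volume hA
      (fun p _ => (hasFDerivAt_polarCoord_symm p).hasFDerivWithinAt) hinj]
  refine setLIntegral_congr_fun hA fun p hp => ?_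
  simp only [det_fderivPolarCoordSymm, abs_of_pos (show (0 : ℝ) < p.1 from (hAs hp).1), hpt]

theorem wMeas_Sset {κ γ ν t θ R : ℝ} (hκ' : κ < 2 * π) (ht : 0 < t) :
    wMeas κ γ ν (Sset κ (polarPt t θ) R) = ∫⁻ p in radSet t R ×ˢ arcSet κ θ (R / t),
      ENNReal.ofReal p.1 * ENNReal.ofReal (wgt κ γ ν (polarPt p.1 p.2)) := by
  rw [wMeas, Sset_eq_image ht]
  exact setLIntegral_image_polarPt hκ'
    ((measurableSet_radSet _ _).prod (measurableSet_arcSet _ _ _))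
    (fun p hp => ⟨hp.1.1, hp.2.1⟩) _

theorem endDist_pos {κ φ : ℝ} (hφ : φ ∈ Ioo 0 κ) : 0 < endDist κ φ :=
  lt_min hφ.1 (sub_pos.2 hφ.2)

theorem wgt_polarPt_comparable {κ γ ν s φ : ℝ} (hκ' : κ < 2 * π) (hs : 0 < s)
    (hφ : φ ∈ Ioo 0 κ) :
    s * wgt κ γ ν (polarPt s φ) ≤ (2 * π) ^ |γ| * (s ^ (ν + 1) * endDist κ φ ^ γ) ∧
      s ^ (ν + 1) * endDist κ φ ^ γ ≤ (2 * π) ^ |γ| * (s * wgt κ γ ν (polarPt s φ)) := by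
  have hπ := Real.pi_gt_three
  have hm := endDist_pos hφ
  have hsm : 0 < s * endDist κ φ := mul_pos hs hm
  have hup := rhoD_polarPt_le hκ' hs hφ
  have hlo := le_rhoD_polarPt hκ' hs hφ
  have hρ : 0 < rhoD κ (polarPt s φ) := lt_of_lt_of_le (by positivity) hlo
  rw [div_le_iff₀ (by positivity), mul_comm (rhoD _ _)] at hlo
  have hup' : rhoD κ (polarPt s φ) ≤ 2 * π * (s * endDist κ φ) := by nlinarith
  have h1 := rpow_le_of_comparable γ (by linarith : 1 ≤ 2 * π) hρ hsm hup' hlo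
  have h2 := rpow_le_of_comparable γ (by linarith : 1 ≤ 2 * π) hsm hρ hlo hup'
  have hpow : s ^ (ν + 1) * endDist κ φ ^ γ =
      s * (s ^ (ν - γ) * (s * endDist κ φ) ^ γ) := by
    rw [Real.mul_rpow hs.le hm.le, ← mul_assoc (s ^ (ν - γ)), ← Real.rpow_add hs, sub_add_cancel,
      Real.rpow_add hs, Real.rpow_one]
    ring
  rw [hpow, wgt, norm_polarPt hs.le]
  have hc : 0 ≤ s * s ^ (ν - γ) := by positivity
  constructor
  · calc _ = s * s ^ (ν - γ) * rhoD κ (polarPt s φ) ^ γ := by ring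
      _ ≤ s * s ^ (ν - γ) * ((2 * π) ^ |γ| * (s * endDist κ φ) ^ γ) := by gcongr
      _ = _ := by ring
  · calc _ = s * s ^ (ν - γ) * (s * endDist κ φ) ^ γ := by ring
      _ ≤ s * s ^ (ν - γ) * ((2 * π) ^ |γ| * rhoD κ (polarPt s φ) ^ γ) := by gcongr
      _ = _ := by ring

theorem setLIntegral_prod_radSet_arcSet (κ γ ν t θ R δ : ℝ) :
    ∫⁻ p in radSet t R ×ˢ arcSet κ θ δ,
      ENNReal.ofReal (p.1 ^ (ν + 1) * endDist κ p.2 ^ γ) =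
    (∫⁻ s in radSet t R, ENNReal.ofReal (s ^ (ν + 1))) *
      ∫⁻ φ in arcSet κ θ δ, ENNReal.ofReal (endDist κ φ ^ γ) := by
  have hmeas : Measurable fun φ => endDist κ φ := by unfold endDist; fun_prop
  rw [← lintegral_prod_mul (by fun_prop) (by fun_prop), Measure.prod_restrict,
    ← Measure.volume_eq_prod]
  refine setLIntegral_congr_fun ((measurableSet_radSet _ _).prod (measurableSet_arcSet _ _ _))
    fun p hp => ?_
  exact ENNReal.ofReal_mul (Real.rpow_nonneg hp.1.1.le _)

theorem wMeas_Sset_comparable {κ γ ν t θ R : ℝ} (hκ' : κ < 2 * π) (ht : 0 < t) :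
    let J := (∫⁻ s in radSet t R, ENNReal.ofReal (s ^ (ν + 1))) *
      ∫⁻ φ in arcSet κ θ (R / t), ENNReal.ofReal (endDist κ φ ^ γ)
    wMeas κ γ ν (Sset κ (polarPt t θ) R) ≤ ENNReal.ofReal ((2 * π) ^ |γ|) * J ∧
      J ≤ ENNReal.ofReal ((2 * π) ^ |γ|) * wMeas κ γ ν (Sset κ (polarPt t θ) R) := by
  intro J
  have hmeas := (measurableSet_radSet t R).prod (measurableSet_arcSet κ θ (R / t))
  have hK : (0 : ℝ) ≤ (2 * π) ^ |γ| := by positivity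
  rw [wMeas_Sset hκ' ht, show J = _ from (setLIntegral_prod_radSet_arcSet κ γ ν t θ R _).symm,
    ← lintegral_const_mul' _ _ ENNReal.ofReal_ne_top,
    ← lintegral_const_mul' _ _ ENNReal.ofReal_ne_top]
  constructor <;> refine setLIntegral_mono' hmeas fun p hp => ?_ <;>
    rw [← ENNReal.ofReal_mul hp.1.1.le, ← ENNReal.ofReal_mul hK] <;>
    refine ENNReal.ofReal_le_ofReal ?_
  · exact (wgt_polarPt_comparable hκ' hp.1.1 hp.2.1).1
  · exact (wgt_polarPt_comparable hκ' hp.1.1 hp.2.1).2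

theorem stmt1 (κ : ℝ) (hκ : 0 < κ) (hκ' : κ < 2 * π)
    (γ ν : ℝ) (hγ : -1 < γ) (hν : -2 < ν) :
    ∃ C : ℝ, 0 < C ∧ ∀ x ∈ Dset κ, ∀ r : ℝ, 0 < r →
      wMeas κ γ ν (Sset κ x (2 * r)) ≤ ENNReal.ofReal C * wMeas κ γ ν (Sset κ x r) := by
  obtain ⟨C₁, hC₁⟩ := setLIntegral_radSet_doubling (a := ν + 1) (by linarith)
  obtain ⟨C₂, hC₂⟩ := setLIntegral_arcSet_doubling hγ hκ hκ'
  set K : ℝ := (2 * π) ^ |γ| with hK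
  have hK0 : 0 ≤ K := by positivity
  refine ⟨K * (C₁ * C₂) * K + 1, by positivity, fun x hx r hr => ?_⟩
  obtain ⟨t, θ, ht, hθ, rfl⟩ := mem_Dset_iff.1 hx
  have hup := (wMeas_Sset_comparable (γ := γ) (ν := ν) (θ := θ) (R := 2 * r) hκ' ht).1
  have hlo := (wMeas_Sset_comparable (γ := γ) (ν := ν) (θ := θ) (R := r) hκ' ht).2
  have h1 := hC₁ t r ht hr
  have h2 := hC₂ θ hθ (r / t) (by positivity)
  rw [← mul_div_assoc] at h2
  calc _ ≤ _ := hup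
    _ ≤ ENNReal.ofReal K * ((C₁ * ∫⁻ s in radSet t r, ENNReal.ofReal (s ^ (ν + 1))) *
        (C₂ * ∫⁻ φ in arcSet κ θ (r / t), ENNReal.ofReal (endDist κ φ ^ γ))) := by gcongr
    _ = ENNReal.ofReal K * (C₁ * C₂) * ((∫⁻ s in radSet t r, ENNReal.ofReal (s ^ (ν + 1))) *
        ∫⁻ φ in arcSet κ θ (r / t), ENNReal.ofReal (endDist κ φ ^ γ)) := by ring
    _ ≤ ENNReal.ofReal K * (C₁ * C₂) *
        (ENNReal.ofReal K * wMeas κ γ ν (Sset κ (polarPt t θ) r)) := by gcongr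
    _ = ENNReal.ofReal (K * (C₁ * C₂) * K) * wMeas κ γ ν (Sset κ (polarPt t θ) r) := by
        rw [ENNReal.ofReal_mul (by positivity), ENNReal.ofReal_mul hK0,
          ENNReal.ofReal_mul C₁.coe_nonneg, ENNReal.ofReal_coe_nnreal, ENNReal.ofReal_coe_nnreal]
        ring
    _ ≤ _ := by
        gcongr
        linarith
end
end

section
/- Let γ ∈ (−1, ∞) and ν ∈ (−2, ∞). Then there exists a finite constant C ≥ 1, depending only on γ, ν and κ, such that 0 < w_{γ,ν}(B(x, 2r)) ≤ C · w_{γ,ν}(B(x, r)) < ∞ for all x in the closure of 𝒟 and all r > 0; that is, the measure with density w_{γ,ν} with respect to Lebesgue measure on 𝒟 satisfies the volume doubling property. -/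
open MeasureTheory Set Real
open scoped ENNReal

noncomputable section

lemma rpow_le_rpow_abs_mul {a b K : ℝ} (p : ℝ) (ha : 0 < a) (hb : 0 < b)
    (hab : a ≤ K * b) (hba : b ≤ K * a) : a ^ p ≤ K ^ |p| * b ^ p := by
  have hK : 0 < K := pos_of_mul_pos_left (ha.trans_le hab) hb.le
  rcases le_total 0 p with hp | hp
  · rw [abs_of_nonneg hp, ← Real.mul_rpow hK.le hb.le]
    exact Real.rpow_le_rpow ha.le hab hp
  · have h := Real.rpow_le_rpow_of_nonpos hb hba hp
    rw [Real.mul_rpow hK.le ha.le] at h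
    rw [abs_of_nonpos hp, Real.rpow_neg hK.le, inv_mul_eq_div, le_div_iff₀ (by positivity)]
    linarith

lemma lintegral_Ioo_rpow {γ : ℝ} (hγ : -1 < γ) {M : ℝ} (hM : 0 ≤ M) :
    ∫⁻ u in Ioo 0 M, ENNReal.ofReal (u ^ γ) = ENNReal.ofReal (M ^ (γ + 1) / (γ + 1)) := by
  have hint := intervalIntegral.intervalIntegrable_rpow' (a := 0) (b := M) hγ
  rw [intervalIntegrable_iff_integrableOn_Ioo_of_le hM] at hint
  rw [← ofReal_integral_eq_lintegral_ofReal hint, ← integral_Ioc_eq_integral_Ioo,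
    ← intervalIntegral.integral_of_le hM, integral_rpow (Or.inl hγ),
    Real.zero_rpow (by linarith), sub_zero]
  exact (ae_restrict_iff' measurableSet_Ioo).2 (ae_of_all _ fun u hu => Real.rpow_nonneg hu.1.le γ)

lemma volume_ball_eq (x : E2) {r : ℝ} (hr : 0 ≤ r) :
    volume (Metric.ball x r) = ENNReal.ofReal (π * r ^ 2) := by
  rw [EuclideanSpace.volume_ball_fin_two, ← ENNReal.ofReal_pow hr,
    ← ENNReal.ofReal_mul (by positivity), mul_comm]

/-- A defining function of a special Lipschitz cone: it grows at rate `s` in the unit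
direction `e`, vanishes at the origin, and is Lipschitz with constant `2`. -/
structure IsDefiningFunction (f : E2 → ℝ) (e : E2) (s : ℝ) : Prop where
  pos : 0 < s
  le_one : s ≤ 1
  norm_eq_one : ‖e‖ = 1
  map_zero : f 0 = 0
  map_add_smul : ∀ y t, f (y + t • e) = f y + s * t
  abs_sub_le : ∀ x y, |f y - f x| ≤ 2 * dist y x

namespace IsDefiningFunction

variable {f : E2 → ℝ} {e : E2} {s : ℝ}

lemma continuous (hf : IsDefiningFunction f e s) : Continuous f := by
  have : LipschitzWith 2 f := LipschitzWith.of_dist_le_mul fun x y => by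
    simpa [Real.dist_eq] using hf.abs_sub_le y x
  exact this.continuous

lemma le_two_mul_norm (hf : IsDefiningFunction f e s) (y : E2) : f y ≤ 2 * ‖y‖ := by
  have := (abs_le.1 (hf.abs_sub_le 0 y)).2
  rw [hf.map_zero, dist_zero_right] at this
  linarith

lemma measurableSet_inter_ball (hf : IsDefiningFunction f e s) (x : E2) (r : ℝ) :
    MeasurableSet ({y | 0 < f y} ∩ Metric.ball x r) :=
  (isOpen_lt continuous_const hf.continuous).measurableSet.inter Metric.isOpen_ball.measurableSet

/-- Averaging over translations in the direction `e` bounds the integral of `f ^ γ` over a ball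
by a one-dimensional integral. -/
lemma mul_lintegral_rpow_le (hf : IsDefiningFunction f e s) {γ : ℝ} (hγ : -1 < γ)
    (x : E2) {r M : ℝ} (hM : 0 ≤ M) (hfM : ∀ y ∈ Metric.ball x r, f y < M) :
    ENNReal.ofReal r * ∫⁻ y in {y | 0 < f y} ∩ Metric.ball x r, ENNReal.ofReal (f y ^ γ) ≤
      ENNReal.ofReal (M ^ (γ + 1) / (γ + 1)) * volume (Metric.ball x (r + r / s)) := by
  have hs := hf.pos
  have hS := hf.measurableSet_inter_ball x r
  set S := {y | 0 < f y} ∩ Metric.ball x r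
  set G : E2 → ℝ≥0∞ := S.indicator fun y => ENNReal.ofReal (f y ^ γ)
  have hG : Measurable G :=
    ((hf.continuous.measurable.pow_const γ).ennreal_ofReal).indicator hS
  have hft : ∀ y t, f (y + (t / s) • e) = f y + t := fun y t => by
    rw [hf.map_add_smul]; field_simp
  have hinner : ∀ y, ∫⁻ t in Ioo 0 r, G (y + (t / s) • e) ≤
      (Metric.ball x (r + r / s)).indicator
        (fun _ => ENNReal.ofReal (M ^ (γ + 1) / (γ + 1))) y := by
    intro y
    by_cases hy : y ∈ Metric.ball x (r + r / s)
    · rw [indicator_of_mem hy, ← lintegral_Ioo_rpow hγ hM]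
      refine (setLIntegral_le_lintegral _ _).trans ?_
      rw [← lintegral_indicator measurableSet_Ioo,
        ← lintegral_add_left_eq_self ((Ioo 0 M).indicator _) (f y)]
      refine lintegral_mono fun t => ?_
      by_cases h : y + (t / s) • e ∈ S
      · have h1 : 0 < f y + t := by simpa [hft] using h.1
        have h2 : f y + t < M := by simpa [hft] using hfM _ h.2
        simp only [G]
        rw [indicator_of_mem h, hft, indicator_of_mem (show f y + t ∈ Ioo 0 M from ⟨h1, h2⟩)]
      · simp [G, indicator_of_notMem h]
    · rw [indicator_of_notMem hy, nonpos_iff_eq_zero, setLIntegral_eq_zero measurableSet_Ioo]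
      intro t ht
      refine indicator_of_notMem (fun h => hy ?_) _
      have h2 : dist (y + (t / s) • e) x < r := h.2
      have h3 : dist y (y + (t / s) • e) = t / s := by
        rw [dist_self_add_right, norm_smul, hf.norm_eq_one, mul_one, Real.norm_of_nonneg]
        exact div_nonneg ht.1.le hs.le
      have h4 : t / s < r / s := div_lt_div_of_pos_right ht.2 hs
      rw [Metric.mem_ball]
      linarith [dist_triangle y (y + (t / s) • e) x]
  calc ENNReal.ofReal r * ∫⁻ y in S, ENNReal.ofReal (f y ^ γ)
      = ∫⁻ _ in Ioo 0 r, ∫⁻ y, G y := by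
        rw [setLIntegral_const, lintegral_indicator hS, Real.volume_Ioo, sub_zero, mul_comm]
    _ = ∫⁻ t in Ioo 0 r, ∫⁻ y, G (y + (t / s) • e) := by
        simp_rw [lintegral_add_right_eq_self]
    _ = ∫⁻ y, ∫⁻ t in Ioo 0 r, G (y + (t / s) • e) := by
        refine lintegral_lintegral_swap (Measurable.aemeasurable (hG.comp ?_))
        fun_prop
    _ ≤ _ := lintegral_mono hinner
    _ = _ := by
        rw [lintegral_indicator Metric.isOpen_ball.measurableSet, setLIntegral_const]

lemma exists_lintegral_rpow_le (hf : IsDefiningFunction f e s) {γ : ℝ} (hγ : -1 < γ) :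
    ∃ C : ℝ, 0 < C ∧ ∀ x : E2, 0 ≤ f x → ∀ r : ℝ, 0 < r →
      ∫⁻ y in {y | 0 < f y} ∩ Metric.ball x r, ENNReal.ofReal (f y ^ γ) ≤
        ENNReal.ofReal (C * ((f x + r) ^ γ * r ^ 2)) := by
  have hs := hf.pos
  have hγ1 : 0 < γ + 1 := by linarith
  set A : ℝ := 5 ^ |γ| * π
  set B : ℝ := 6 ^ (γ + 1) / (γ + 1) * (π * (1 + 1 / s) ^ 2) * 5 ^ |γ|
  have hA : 0 < A := by positivity
  have hB : 0 < B := by positivity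
  refine ⟨A + B, by positivity, fun x hx r hr => ?_⟩
  have hE : 0 ≤ (f x + r) ^ γ * r ^ 2 := by positivity
  have hdiff : ∀ y ∈ Metric.ball x r, |f y - f x| < 2 * r := fun y hy =>
    (hf.abs_sub_le x y).trans_lt (by have := Metric.mem_ball.1 hy; linarith)
  rcases le_or_gt (4 * r) (f x) with h4 | h4
  · calc ∫⁻ y in {y | 0 < f y} ∩ Metric.ball x r, ENNReal.ofReal (f y ^ γ)
        ≤ ∫⁻ _ in {y | 0 < f y} ∩ Metric.ball x r, ENNReal.ofReal (5 ^ |γ| * (f x + r) ^ γ) := by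
          refine setLIntegral_mono measurable_const fun y hy => ENNReal.ofReal_le_ofReal ?_
          have := abs_lt.1 (hdiff y hy.2)
          exact rpow_le_rpow_abs_mul γ hy.1 (by positivity) (by linarith) (by linarith)
      _ ≤ ENNReal.ofReal (5 ^ |γ| * (f x + r) ^ γ) * ENNReal.ofReal (π * r ^ 2) := by
          rw [setLIntegral_const, ← volume_ball_eq x hr.le]
          gcongr
          exact inter_subset_right
      _ ≤ _ := by
          rw [← ENNReal.ofReal_mul (by positivity)]
          refine ENNReal.ofReal_le_ofReal ?_
          calc _ = A * ((f x + r) ^ γ * r ^ 2) := by simp only [A]; ring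
            _ ≤ _ := by gcongr; linarith
  · have key := hf.mul_lintegral_rpow_le hγ x (M := 6 * r) (by positivity) fun y hy => by
      have := abs_lt.1 (hdiff y hy)
      linarith
    have hr0 : ENNReal.ofReal r ≠ 0 := by simpa using hr
    rw [← ENNReal.mul_le_mul_iff_right hr0 ENNReal.ofReal_ne_top]
    refine key.trans ?_
    rw [volume_ball_eq x (by positivity), ← ENNReal.ofReal_mul (by positivity),
      ← ENNReal.ofReal_mul hr.le]
    refine ENNReal.ofReal_le_ofReal ?_
    have hcmp : r ^ γ ≤ 5 ^ |γ| * (f x + r) ^ γ :=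
      rpow_le_rpow_abs_mul γ hr (by positivity) (by linarith) (by linarith)
    calc (6 * r) ^ (γ + 1) / (γ + 1) * (π * (r + r / s) ^ 2)
        = r * (6 ^ (γ + 1) / (γ + 1) * (π * (1 + 1 / s) ^ 2) * r ^ γ * r ^ 2) := by
          rw [Real.mul_rpow (by norm_num) hr.le, Real.rpow_add_one hr.ne']
          ring
      _ ≤ r * (6 ^ (γ + 1) / (γ + 1) * (π * (1 + 1 / s) ^ 2) *
            (5 ^ |γ| * (f x + r) ^ γ) * r ^ 2) := by
          gcongr
      _ = r * (B * ((f x + r) ^ γ * r ^ 2)) := by simp only [B]; ring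
      _ ≤ _ := by gcongr; linarith

lemma lintegral_norm_rpow_mul_le (hf : IsDefiningFunction f e s) {γ p : ℝ} {S : Set E2} {x : E2}
    {r a K I : ℝ} (hS : MeasurableSet S) (hSx : S ⊆ {y | 0 < f y} ∩ Metric.ball x r) (ha : 0 < a)
    (hK : 0 < K) (hSa : ∀ y ∈ S, ‖y‖ ≤ K * a ∧ a ≤ K * ‖y‖)
    (hI : ∫⁻ y in {y | 0 < f y} ∩ Metric.ball x r, ENNReal.ofReal (f y ^ γ) ≤ ENNReal.ofReal I) :
    ∫⁻ y in S, ENNReal.ofReal (‖y‖ ^ p * f y ^ γ) ≤ ENNReal.ofReal (K ^ |p| * a ^ p * I) := by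
  have h0 : 0 ≤ K ^ |p| * a ^ p := by positivity
  calc ∫⁻ y in S, ENNReal.ofReal (‖y‖ ^ p * f y ^ γ)
      ≤ ∫⁻ y in S, ENNReal.ofReal (K ^ |p| * a ^ p) * ENNReal.ofReal (f y ^ γ) := by
        refine setLIntegral_mono' hS fun y hy => ?_
        obtain ⟨h1, h2⟩ := hSa y hy
        have hfy : 0 < f y := (hSx hy).1
        have hy0 : 0 < ‖y‖ := by linarith [hf.le_two_mul_norm y]
        rw [← ENNReal.ofReal_mul h0]
        refine ENNReal.ofReal_le_ofReal ?_
        gcongr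
        exact rpow_le_rpow_abs_mul p hy0 ha h1 h2
    _ = ENNReal.ofReal (K ^ |p| * a ^ p) * ∫⁻ y in S, ENNReal.ofReal (f y ^ γ) :=
        lintegral_const_mul' _ _ ENNReal.ofReal_ne_top
    _ ≤ ENNReal.ofReal (K ^ |p| * a ^ p) * ENNReal.ofReal I := by
        gcongr
        exact (lintegral_mono_set hSx).trans hI
    _ = _ := (ENNReal.ofReal_mul h0).symm

/-- Summing over dyadic annuli bounds the mixed weight on balls around the vertex. -/
lemma exists_lintegral_ball_zero_le (hf : IsDefiningFunction f e s) {γ ν : ℝ} (hγ : -1 < γ)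
    (hν : -2 < ν) : ∃ C : ℝ, 0 < C ∧ ∀ R : ℝ, 0 < R →
      ∫⁻ y in {y | 0 < f y} ∩ Metric.ball 0 R, ENNReal.ofReal (‖y‖ ^ (ν - γ) * f y ^ γ) ≤
        ENNReal.ofReal (C * R ^ (ν + 2)) := by
  obtain ⟨C, hC, hfC⟩ := hf.exists_lintegral_rpow_le hγ
  set q : ℝ := (1 / 2 : ℝ) ^ (ν + 2)
  have hq0 : 0 < q := by positivity
  have hq1 : q < 1 := Real.rpow_lt_one (by norm_num) (by norm_num) (by linarith)
  set A : ℝ := 4 ^ |ν - γ| * C * 2 ^ (ν + 2)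
  have hA : 0 < A := by positivity
  refine ⟨A * (1 - q)⁻¹, mul_pos hA (inv_pos.2 (by linarith)), fun R hR => ?_⟩
  set ρ : ℕ → ℝ := fun n => 2 * R * (1 / 2) ^ n
  have hρ : ∀ n, 0 < ρ n := fun n => by positivity
  set S : ℕ → Set E2 := fun n => {y | 0 < f y} ∩ Metric.ball 0 (ρ n) ∩ {y | ρ n < 4 * ‖y‖}
  have hS : ∀ n, MeasurableSet (S n) := fun n => (hf.measurableSet_inter_ball 0 (ρ n)).inter
    (measurableSet_lt measurable_const (by fun_prop))
  have hcover : {y | 0 < f y} ∩ Metric.ball 0 R ⊆ ⋃ n, S n := by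
    rintro y ⟨hy, hyR⟩
    have hy' : 0 < f y := hy
    have hy0 : 0 < ‖y‖ := by linarith [hf.le_two_mul_norm y]
    have hyR' : ‖y‖ < R := by simpa using hyR
    obtain ⟨n, h1, h2⟩ := exists_nat_pow_near_of_lt_one (x := ‖y‖ / R) (y := (1 / 2 : ℝ))
      (by positivity) ((div_le_one hR).2 hyR'.le) (by norm_num) (by norm_num)
    rw [lt_div_iff₀ hR, pow_succ] at h1
    rw [div_le_iff₀ hR] at h2
    have := hρ n
    refine mem_iUnion.2 ⟨n, ⟨hy, ?_⟩, ?_⟩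
    · rw [mem_ball_zero_iff]
      simp only [ρ] at this ⊢
      linarith
    · simp only [mem_ofPred_eq, ρ] at this ⊢
      linarith
  have hterm : ∀ n, ∫⁻ y in S n, ENNReal.ofReal (‖y‖ ^ (ν - γ) * f y ^ γ) ≤
      ENNReal.ofReal (A * R ^ (ν + 2) * q ^ n) := by
    intro n
    refine (hf.lintegral_norm_rpow_mul_le (K := 4) (hS n) inter_subset_left (hρ n) (by norm_num)
      (fun y hy => ?_) (hfC 0 hf.map_zero.ge (ρ n) (hρ n))).trans_eq ?_
    · have h1 : ‖y‖ < ρ n := by simpa using hy.1.2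
      have h2 : ρ n < 4 * ‖y‖ := hy.2
      exact ⟨by linarith [hρ n], h2.le⟩
    · congr 1
      have hsplit : ρ n ^ (ν - γ) * (ρ n ^ γ * ρ n ^ 2) = ρ n ^ (ν + 2) := by
        rw [← Real.rpow_natCast (ρ n) 2, ← Real.rpow_add (hρ n), ← Real.rpow_add (hρ n)]
        congr 1
        push_cast
        ring
      have hpow : ρ n ^ (ν + 2) = 2 ^ (ν + 2) * R ^ (ν + 2) * q ^ n := by
        simp only [ρ, q]
        rw [Real.mul_rpow (by positivity) (by positivity), Real.mul_rpow (by norm_num) hR.le,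
          ← Real.rpow_natCast, ← Real.rpow_natCast, ← Real.rpow_mul (by norm_num),
          ← Real.rpow_mul (by norm_num), mul_comm (n : ℝ)]
      rw [hf.map_zero, zero_add]
      calc _ = 4 ^ |ν - γ| * C * (ρ n ^ (ν - γ) * (ρ n ^ γ * ρ n ^ 2)) := by ring
        _ = _ := by rw [hsplit, hpow]; simp only [A]; ring
  calc _ ≤ ∑' n, ∫⁻ y in S n, ENNReal.ofReal (‖y‖ ^ (ν - γ) * f y ^ γ) :=
        (lintegral_mono_set hcover).trans (lintegral_iUnion_le S _)
    _ ≤ ∑' n, ENNReal.ofReal (A * R ^ (ν + 2) * q ^ n) := ENNReal.tsum_le_tsum hterm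
    _ = ENNReal.ofReal (A * (1 - q)⁻¹ * R ^ (ν + 2)) := by
        rw [← ENNReal.ofReal_tsum_of_nonneg (fun n => by positivity)
          ((summable_geometric_of_lt_one hq0.le hq1).mul_left _), tsum_mul_left,
          tsum_geometric_of_lt_one hq0.le hq1]
        congr 1
        ring

lemma exists_lintegral_le (hf : IsDefiningFunction f e s) {γ ν : ℝ} (hγ : -1 < γ)
    (hν : -2 < ν) : ∃ C : ℝ, 0 < C ∧ ∀ x : E2, 0 ≤ f x → ∀ r : ℝ, 0 < r →
      ∫⁻ y in {y | 0 < f y} ∩ Metric.ball x r, ENNReal.ofReal (‖y‖ ^ (ν - γ) * f y ^ γ) ≤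
        ENNReal.ofReal (C * ((‖x‖ + r) ^ (ν - γ) * (f x + r) ^ γ * r ^ 2)) := by
  obtain ⟨A, hA, hfA⟩ := hf.exists_lintegral_rpow_le hγ
  obtain ⟨B, hB, hfB⟩ := hf.exists_lintegral_ball_zero_le hγ hν
  set A' : ℝ := 3 ^ |ν - γ| * A
  set B' : ℝ := B * 3 ^ (ν + 2) * 3 ^ |ν - γ| * 5 ^ |γ|
  have hA' : 0 < A' := by positivity
  have hB' : 0 < B' := by positivity
  refine ⟨A' + B', by positivity, fun x hx r hr => ?_⟩
  rcases le_or_gt (2 * r) ‖x‖ with h | h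
  · refine (hf.lintegral_norm_rpow_mul_le (K := 3) (a := ‖x‖ + r)
      (hf.measurableSet_inter_ball x r) Subset.rfl (by positivity) (by norm_num)
      (fun y hy => ?_) (hfA x hx r hr)).trans (ENNReal.ofReal_le_ofReal ?_)
    · have hd : ‖y - x‖ < r := by simpa [dist_eq_norm] using hy.2
      have h1 := norm_sub_norm_le y x
      have h2 := norm_sub_norm_le x y
      rw [norm_sub_rev] at h2
      constructor <;> linarith
    · calc _ = A' * ((‖x‖ + r) ^ (ν - γ) * (f x + r) ^ γ * r ^ 2) := by simp only [A']; ring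
        _ ≤ _ := by gcongr; linarith
  · have hsub : {y | 0 < f y} ∩ Metric.ball x r ⊆ {y | 0 < f y} ∩ Metric.ball 0 (3 * r) :=
      inter_subset_inter_right _ (Metric.ball_subset_ball' (by rw [dist_zero_right]; linarith))
    refine ((lintegral_mono_set hsub).trans (hfB (3 * r) (by positivity))).trans
      (ENNReal.ofReal_le_ofReal ?_)
    have hfx := hf.le_two_mul_norm x
    have hnx := norm_nonneg x
    have h1 : r ^ (ν - γ) ≤ 3 ^ |ν - γ| * (‖x‖ + r) ^ (ν - γ) :=
      rpow_le_rpow_abs_mul _ hr (by positivity) (by linarith) (by linarith)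
    have h2 : r ^ γ ≤ 5 ^ |γ| * (f x + r) ^ γ :=
      rpow_le_rpow_abs_mul _ hr (by positivity) (by linarith) (by linarith)
    have hsplit : r ^ (ν + 2) = r ^ (ν - γ) * r ^ γ * r ^ 2 := by
      rw [← Real.rpow_natCast r 2, ← Real.rpow_add hr, ← Real.rpow_add hr]
      congr 1
      push_cast
      ring
    calc B * (3 * r) ^ (ν + 2) = B * 3 ^ (ν + 2) * (r ^ (ν - γ) * r ^ γ * r ^ 2) := by
          rw [Real.mul_rpow (by norm_num) hr.le, hsplit]
          ring
      _ ≤ B * 3 ^ (ν + 2) * ((3 ^ |ν - γ| * (‖x‖ + r) ^ (ν - γ)) *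
            (5 ^ |γ| * (f x + r) ^ γ) * r ^ 2) := by
          gcongr
      _ = B' * ((‖x‖ + r) ^ (ν - γ) * (f x + r) ^ γ * r ^ 2) := by simp only [B']; ring
      _ ≤ _ := by gcongr; linarith

/-- A ball of radius comparable to `r` on which `f` is comparable to `f x + r` bounds the mixed
weight from below. -/
lemma exists_le_lintegral (hf : IsDefiningFunction f e s) (γ ν : ℝ) :
    ∃ c : ℝ, 0 < c ∧ ∀ x : E2, 0 ≤ f x → ∀ r : ℝ, 0 < r →
      ENNReal.ofReal (c * ((‖x‖ + r) ^ (ν - γ) * (f x + r) ^ γ * r ^ 2)) ≤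
        ∫⁻ y in {y | 0 < f y} ∩ Metric.ball x r, ENNReal.ofReal (‖y‖ ^ (ν - γ) * f y ^ γ) := by
  have hs := hf.pos
  have hs1 := hf.le_one
  set K : ℝ := 1 + 16 / s
  have hKs : K * s = s + 16 := by simp only [K]; field_simp
  have hK1 : 2 ≤ K := by
    have : 1 ≤ 16 / s := (one_le_div hs).2 (by linarith)
    simp only [K]; linarith
  have hK0 : 0 < K := by linarith
  set L : ℝ := (K ^ |ν - γ|)⁻¹ * (K ^ |γ|)⁻¹
  have hL : 0 < L := by positivity
  refine ⟨L * (π * (s / 8) ^ 2), by positivity, fun x hx r hr => ?_⟩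
  set z : E2 := x + (r / 2) • e
  have hzx : dist z x = r / 2 := by
    rw [dist_self_add_left, norm_smul, hf.norm_eq_one, mul_one, Real.norm_of_nonneg (by positivity)]
  have hfz : f z = f x + s * (r / 2) := hf.map_add_smul x (r / 2)
  have hsr : s * r ≤ r := by nlinarith
  have hsr0 : 0 < s * r := by positivity
  have hlow : ∀ y ∈ Metric.ball z (s / 8 * r), f x + s * r / 4 ≤ f y := fun y hy => by
    have h1 := (abs_le.1 (hf.abs_sub_le z y)).1
    have h2 := Metric.mem_ball.1 hy
    linarith
  have hball : ∀ y ∈ Metric.ball z (s / 8 * r), dist y x < r := fun y hy => by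
    have h2 := Metric.mem_ball.1 hy
    linarith [dist_triangle y z x]
  have hpt : ∀ y ∈ Metric.ball z (s / 8 * r),
      L * ((‖x‖ + r) ^ (ν - γ) * (f x + r) ^ γ) ≤ ‖y‖ ^ (ν - γ) * f y ^ γ := by
    intro y hy
    have hyf := hlow y hy
    have hyx := hball y hy
    have hfy : 0 < f y := by linarith
    have hupp := (abs_le.1 (hf.abs_sub_le x y)).2
    have hnf := hf.le_two_mul_norm y
    have hny : 0 < ‖y‖ := by linarith
    have h1 := norm_sub_norm_le y x
    have h2 := norm_sub_norm_le x y
    rw [norm_sub_rev] at h2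
    rw [dist_eq_norm] at hyx hupp
    have hnx := norm_nonneg x
    have hKy : s * r * K ≤ 8 * ‖y‖ * K :=
      mul_le_mul_of_nonneg_right (by linarith) hK0.le
    have hKf : (f x + s * r / 4) * K ≤ f y * K := by gcongr
    have hKfx : f x * 2 ≤ f x * K := by gcongr
    have hKx : (‖x‖ + r) * 2 ≤ (‖x‖ + r) * K := by gcongr
    have hKfr : (f x + r) * 2 ≤ (f x + r) * K := by gcongr
    have hKr : s * r * K = s * r + 16 * r := by linear_combination r * hKs
    have hKy' : 8 * ‖y‖ * K = 8 * ‖y‖ + 128 * (‖y‖ / s) := by simp only [K]; ring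
    have hys : s * r / 8 / s ≤ ‖y‖ / s := by gcongr; linarith
    have hys' : s * r / 8 / s = r / 8 := by field_simp
    have e1 : (‖x‖ + r) ^ (ν - γ) ≤ K ^ |ν - γ| * ‖y‖ ^ (ν - γ) :=
      rpow_le_rpow_abs_mul _ (by positivity) hny (by linarith) (by linarith)
    have e2 : (f x + r) ^ γ ≤ K ^ |γ| * f y ^ γ :=
      rpow_le_rpow_abs_mul _ (by positivity) hfy (by linarith) (by linarith)
    calc L * ((‖x‖ + r) ^ (ν - γ) * (f x + r) ^ γ)
        ≤ L * ((K ^ |ν - γ| * ‖y‖ ^ (ν - γ)) * (K ^ |γ| * f y ^ γ)) := by gcongr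
      _ = _ := by simp only [L]; field_simp
  have hsub : Metric.ball z (s / 8 * r) ⊆ {y | 0 < f y} ∩ Metric.ball x r := fun y hy =>
    ⟨by have := hlow y hy; rw [mem_ofPred_eq]; linarith, hball y hy⟩
  calc _ = ENNReal.ofReal (L * ((‖x‖ + r) ^ (ν - γ) * (f x + r) ^ γ)) *
        volume (Metric.ball z (s / 8 * r)) := by
        rw [volume_ball_eq z (by positivity), ← ENNReal.ofReal_mul (by positivity)]
        congr 1
        ring
    _ = ∫⁻ _ in Metric.ball z (s / 8 * r),
          ENNReal.ofReal (L * ((‖x‖ + r) ^ (ν - γ) * (f x + r) ^ γ)) := by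
        rw [setLIntegral_const]
    _ ≤ ∫⁻ y in Metric.ball z (s / 8 * r), ENNReal.ofReal (‖y‖ ^ (ν - γ) * f y ^ γ) :=
        setLIntegral_mono' Metric.isOpen_ball.measurableSet fun y hy =>
          ENNReal.ofReal_le_ofReal (hpt y hy)
    _ ≤ _ := lintegral_mono_set hsub

/-- The distance to the boundary of the cone `{0 < f}` is comparable to `f`. -/
lemma infDist_frontier_comparable (hf : IsDefiningFunction f e s) {y : E2} (hy : 0 < f y) :
    f y / 2 ≤ Metric.infDist y (frontier {y | 0 < f y}) ∧
      Metric.infDist y (frontier {y | 0 < f y}) ≤ f y / s := by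
  have hs := hf.pos
  have hmem : y + (-(f y / s)) • e ∈ frontier {y | 0 < f y} := by
    have hzero : f (y + (-(f y / s)) • e) = 0 := by rw [hf.map_add_smul]; field_simp; ring
    rw [(isOpen_lt continuous_const hf.continuous).frontier_eq]
    refine ⟨Metric.mem_closure_iff.2 fun ε hε =>
      ⟨y + (-(f y / s)) • e + (ε / 2) • e, ?_, ?_⟩, fun h => (ne_of_gt h) hzero⟩
    · rw [mem_ofPred_eq, hf.map_add_smul, hzero]
      positivity
    · rw [dist_self_add_right, norm_smul, hf.norm_eq_one, mul_one,
        Real.norm_of_nonneg (by positivity)]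
      linarith
  constructor
  · refine (Metric.le_infDist ⟨_, hmem⟩).2 fun z hz => ?_
    have hz0 : 0 = f z := frontier_lt_subset_eq continuous_const hf.continuous hz
    have := (abs_le.1 (hf.abs_sub_le z y)).2
    linarith
  · refine (Metric.infDist_le_dist_of_mem hmem).trans_eq ?_
    rw [dist_self_add_right, norm_smul, hf.norm_eq_one, mul_one, norm_neg,
      Real.norm_of_nonneg (by positivity)]

end IsDefiningFunction

/-- The defining function `r sin (α - |θ|)` of the sector of half-opening `α` around the direction
`(cos α, sin α)`, where `θ` is the angle to that direction. -/
def sectorFun (α : ℝ) (y : E2) : ℝ :=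
  sin α * (cos α * y 0 + sin α * y 1) - cos α * |cos α * y 1 - sin α * y 0|

lemma sectorFun_polar (α r θ : ℝ) {y : E2} (hr : 0 ≤ r) (h0 : y 0 = r * cos (θ + α))
    (h1 : y 1 = r * sin (θ + α)) (hθ : |θ| ≤ π) : sectorFun α y = r * sin (α - |θ|) := by
  have hp : cos α * y 0 + sin α * y 1 = r * cos θ := by
    rw [h0, h1, cos_add, sin_add]
    linear_combination r * cos θ * sin_sq_add_cos_sq α
  have hq : cos α * y 1 - sin α * y 0 = r * sin θ := by
    rw [h0, h1, cos_add, sin_add]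
    linear_combination r * sin θ * sin_sq_add_cos_sq α
  have habs : |sin θ| = sin |θ| := abs_sin_eq_sin_abs_of_abs_le_pi hθ
  rw [sectorFun, hp, hq, abs_mul, abs_of_nonneg hr, habs, sin_sub, cos_abs]
  ring

lemma Dset_eq {κ : ℝ} (hκ : 0 < κ) (hκ' : κ < 2 * π) :
    Dset κ = {y | 0 < sectorFun (κ / 2) y} := by
  ext y
  constructor
  · rintro ⟨r, φ, hr, hφ, hφκ, h0, h1⟩
    have hθ : |φ - κ / 2| < κ / 2 := abs_lt.2 ⟨by linarith, by linarith⟩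
    have h := sectorFun_polar (κ / 2) r (φ - κ / 2) hr.le (by simpa using h0) (by simpa using h1)
      (by linarith)
    rw [mem_ofPred_eq, h]
    exact mul_pos hr (sin_pos_of_pos_of_lt_pi (by linarith)
      (by linarith [abs_nonneg (φ - κ / 2)]))
  · intro hy
    rw [mem_ofPred_eq] at hy
    set α := κ / 2
    set z : ℂ := ⟨cos α * y 0 + sin α * y 1, cos α * y 1 - sin α * y 0⟩
    have hre : ‖z‖ * cos z.arg = cos α * y 0 + sin α * y 1 := Complex.norm_mul_cos_arg z
    have him : ‖z‖ * sin z.arg = cos α * y 1 - sin α * y 0 := Complex.norm_mul_sin_arg z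
    have hθ : |z.arg| ≤ π := Complex.abs_arg_le_pi z
    have h0 : y 0 = ‖z‖ * cos (z.arg + α) := by
      rw [cos_add]
      linear_combination -cos α * hre + sin α * him - y 0 * sin_sq_add_cos_sq α
    have h1 : y 1 = ‖z‖ * sin (z.arg + α) := by
      rw [sin_add]
      linear_combination -sin α * hre - cos α * him - y 1 * sin_sq_add_cos_sq α
    have h := sectorFun_polar α ‖z‖ z.arg (norm_nonneg z) h0 h1 hθ
    rw [h] at hy
    have hz : 0 < ‖z‖ := (norm_nonneg z).lt_of_ne fun h => by simp [← h] at hy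
    have hlt : |z.arg| < α := by
      by_contra! hle
      have := sin_nonpos_of_nonpos_of_neg_pi_le (x := α - |z.arg|) (by linarith)
        (by simp only [α]; linarith)
      nlinarith
    obtain ⟨hl, hu⟩ := abs_lt.1 hlt
    exact ⟨‖z‖, z.arg + α, hz, by linarith, by simp only [α] at hu ⊢; linarith, h0, h1⟩

lemma isDefiningFunction_sectorFun {α : ℝ} (hα : 0 < α) (hα' : α < π) :
    IsDefiningFunction (sectorFun α) !₂[cos α, sin α] (sin α) where
  pos := sin_pos_of_pos_of_lt_pi hα hα'
  le_one := sin_le_one α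
  norm_eq_one := by
    simp [EuclideanSpace.norm_eq]
  map_zero := by simp [sectorFun]
  map_add_smul y t := by
    have hq : cos α * (y 1 + t * sin α) - sin α * (y 0 + t * cos α) =
        cos α * y 1 - sin α * y 0 := by ring
    simp only [sectorFun, PiLp.add_apply, PiLp.smul_apply, smul_eq_mul, Matrix.cons_val_zero,
      Matrix.cons_val_one, hq]
    linear_combination sin α * t * sin_sq_add_cos_sq α
  abs_sub_le x y := by
    have hnorm : ‖y - x‖ ^ 2 = (y 0 - x 0) ^ 2 + (y 1 - x 1) ^ 2 := by
      simp [EuclideanSpace.norm_sq_eq]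
    set a := y 0 - x 0
    set b := y 1 - x 1
    have hcs := sin_sq_add_cos_sq α
    have hp : |cos α * a + sin α * b| ≤ ‖y - x‖ :=
      abs_le_of_sq_le_sq (by rw [hnorm]; nlinarith [sq_nonneg (cos α * b - sin α * a)])
        (norm_nonneg _)
    have hq : |cos α * b - sin α * a| ≤ ‖y - x‖ :=
      abs_le_of_sq_le_sq (by rw [hnorm]; nlinarith [sq_nonneg (cos α * a + sin α * b)])
        (norm_nonneg _)
    have hq' : |(|cos α * y 1 - sin α * y 0| - |cos α * x 1 - sin α * x 0|)| ≤ ‖y - x‖ := by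
      refine (abs_abs_sub_abs_le_abs_sub _ _).trans ((congrArg abs ?_).trans_le hq)
      ring
    calc |sectorFun α y - sectorFun α x|
        = |sin α * (cos α * a + sin α * b) - cos α *
            (|cos α * y 1 - sin α * y 0| - |cos α * x 1 - sin α * x 0|)| := by
          congr 1
          simp only [sectorFun, a, b]
          ring
      _ ≤ |sin α| * |cos α * a + sin α * b| + |cos α| *
            |(|cos α * y 1 - sin α * y 0| - |cos α * x 1 - sin α * x 0|)| := by
          rw [← abs_mul, ← abs_mul]
          exact abs_sub _ _
      _ ≤ 1 * ‖y - x‖ + 1 * ‖y - x‖ := by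
          gcongr
          · exact abs_sin_le_one α
          · exact abs_cos_le_one α
      _ = 2 * dist y x := by rw [dist_eq_norm]; ring

theorem stmt3 (κ : ℝ) (hκ : 0 < κ) (hκ' : κ < 2 * π)
    (γ ν : ℝ) (hγ : -1 < γ) (hν : -2 < ν) :
    ∃ C : ℝ, 1 ≤ C ∧ ∀ x ∈ closure (Dset κ), ∀ r : ℝ, 0 < r →
      0 < wMeas κ γ ν (ballD κ x (2 * r)) ∧
      wMeas κ γ ν (ballD κ x (2 * r)) ≤ ENNReal.ofReal C * wMeas κ γ ν (ballD κ x r) ∧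
      wMeas κ γ ν (ballD κ x r) < ⊤ := by
  have hf := isDefiningFunction_sectorFun (α := κ / 2) (by linarith) (by linarith)
  have hD := Dset_eq hκ hκ'
  set f := sectorFun (κ / 2)
  set s := sin (κ / 2)
  have hs := hf.pos
  have hs1 := hf.le_one
  obtain ⟨A, hA, hup⟩ := hf.exists_lintegral_le hγ hν
  obtain ⟨c, hc, hlow⟩ := hf.exists_le_lintegral γ ν
  set K : ℝ := 2 / s
  have hK : 0 < K := by positivity
  have hKf : ∀ t : ℝ, t / s = K * t / 2 := fun t => by simp only [K]; ring
  have hK2 : 2 ≤ K := (le_div_iff₀ hs).2 (by linarith)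
  have hcmp : ∀ y, 0 < f y → rhoD κ y ^ γ ≤ K ^ |γ| * f y ^ γ ∧
      f y ^ γ ≤ K ^ |γ| * rhoD κ y ^ γ := by
    intro y hy
    obtain ⟨h1, h2⟩ := hf.infDist_frontier_comparable hy
    rw [← hD] at h1 h2
    change f y / 2 ≤ rhoD κ y at h1
    change rhoD κ y ≤ f y / s at h2
    have hρ : 0 < rhoD κ y := by linarith
    rw [hKf] at h2
    have hKy : 0 < K * f y := by positivity
    have hKρ : 2 * rhoD κ y ≤ K * rhoD κ y := by gcongr
    exact ⟨rpow_le_rpow_abs_mul γ hρ hy (by linarith) (by linarith),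
      rpow_le_rpow_abs_mul γ hy hρ (by linarith) (by linarith)⟩
  have hball : ∀ x r, ballD κ x r = {y | 0 < f y} ∩ Metric.ball x r := fun x r => by
    rw [← hD]; rfl
  have hmul : ∀ {S : Set E2} {g h : E2 → ℝ}, MeasurableSet S →
      (∀ y ∈ S, g y ≤ K ^ |γ| * h y) → ∫⁻ y in S, ENNReal.ofReal (g y) ≤
        ENNReal.ofReal (K ^ |γ|) * ∫⁻ y in S, ENNReal.ofReal (h y) := by
    intro S g h hS hgh
    rw [← lintegral_const_mul' _ _ ENNReal.ofReal_ne_top]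
    refine setLIntegral_mono' hS fun y hy => ?_
    rw [← ENNReal.ofReal_mul (by positivity)]
    exact ENNReal.ofReal_le_ofReal (hgh y hy)
  have hwle : ∀ x r, wMeas κ γ ν (ballD κ x r) ≤ ENNReal.ofReal (K ^ |γ|) *
      ∫⁻ y in {y | 0 < f y} ∩ Metric.ball x r, ENNReal.ofReal (‖y‖ ^ (ν - γ) * f y ^ γ) := by
    intro x r
    rw [hball]
    refine hmul (hf.measurableSet_inter_ball x r) fun y hy => ?_
    calc wgt κ γ ν y ≤ ‖y‖ ^ (ν - γ) * (K ^ |γ| * f y ^ γ) :=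
          mul_le_mul_of_nonneg_left (hcmp y hy.1).1 (by positivity)
      _ = _ := by ring
  have hlew : ∀ x r, ∫⁻ y in {y | 0 < f y} ∩ Metric.ball x r,
      ENNReal.ofReal (‖y‖ ^ (ν - γ) * f y ^ γ) ≤
        ENNReal.ofReal (K ^ |γ|) * wMeas κ γ ν (ballD κ x r) := by
    intro x r
    rw [hball]
    refine hmul (hf.measurableSet_inter_ball x r) fun y hy => ?_
    calc _ ≤ ‖y‖ ^ (ν - γ) * (K ^ |γ| * rhoD κ y ^ γ) :=
          mul_le_mul_of_nonneg_left (hcmp y hy.1).2 (by positivity)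
      _ = _ := by rw [wgt]; ring
  have hclosure : ∀ x ∈ closure (Dset κ), 0 ≤ f x := fun x hx =>
    closure_lt_subset_le continuous_const hf.continuous (hD ▸ hx)
  set P : E2 → ℝ → ℝ := fun x r => (‖x‖ + r) ^ (ν - γ) * (f x + r) ^ γ * r ^ 2
  have hPpos : ∀ x, 0 ≤ f x → ∀ r, 0 < r → 0 < P x r := fun x hx r hr => by
    simp only [P]; positivity
  set T : ℝ := 2 ^ |ν - γ| * 2 ^ |γ| * 4
  have hPdouble : ∀ x, 0 ≤ f x → ∀ r, 0 < r → P x (2 * r) ≤ T * P x r := fun x hx r hr => by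
    have hnx := norm_nonneg x
    have h1 : (‖x‖ + 2 * r) ^ (ν - γ) ≤ 2 ^ |ν - γ| * (‖x‖ + r) ^ (ν - γ) :=
      rpow_le_rpow_abs_mul _ (by positivity) (by positivity) (by linarith) (by linarith)
    have h2 : (f x + 2 * r) ^ γ ≤ 2 ^ |γ| * (f x + r) ^ γ :=
      rpow_le_rpow_abs_mul _ (by positivity) (by positivity) (by linarith) (by linarith)
    calc P x (2 * r) ≤ (2 ^ |ν - γ| * (‖x‖ + r) ^ (ν - γ)) * (2 ^ |γ| * (f x + r) ^ γ) *
          (2 * r) ^ 2 := by simp only [P]; gcongr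
      _ = T * P x r := by simp only [P, T]; ring
  set B : ℝ := K ^ |γ| * (A * T / c) * K ^ |γ|
  refine ⟨max 1 B, le_max_left _ _, fun x hx r hr => ⟨?_, ?_, ?_⟩⟩
  · have hP := hPpos x (hclosure x hx) (2 * r) (by positivity)
    have h := (hlow x (hclosure x hx) (2 * r) (by positivity)).trans (hlew x (2 * r))
    refine pos_iff_ne_zero.2 fun h0 => ?_
    rw [h0, mul_zero, nonpos_iff_eq_zero, ENNReal.ofReal_eq_zero] at h
    exact absurd h (not_le.2 (mul_pos hc hP))
  · have hfx := hclosure x hx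
    calc wMeas κ γ ν (ballD κ x (2 * r))
        ≤ ENNReal.ofReal (K ^ |γ|) * ENNReal.ofReal (A * P x (2 * r)) :=
          (hwle x (2 * r)).trans (by gcongr; exact hup x hfx (2 * r) (by positivity))
      _ ≤ ENNReal.ofReal (K ^ |γ|) * (ENNReal.ofReal (A * T / c) * ENNReal.ofReal (c * P x r)) := by
          rw [← ENNReal.ofReal_mul (p := A * T / c) (by positivity)]
          refine mul_le_mul_right (ENNReal.ofReal_le_ofReal ?_) _
          calc A * P x (2 * r) ≤ A * (T * P x r) := by gcongr; exact hPdouble x hfx r hr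
            _ = A * T / c * (c * P x r) := by field_simp
      _ ≤ ENNReal.ofReal (K ^ |γ|) * (ENNReal.ofReal (A * T / c) *
            (ENNReal.ofReal (K ^ |γ|) * wMeas κ γ ν (ballD κ x r))) := by
          gcongr
          exact (hlow x hfx r hr).trans (hlew x r)
      _ = ENNReal.ofReal B * wMeas κ γ ν (ballD κ x r) := by
          rw [← mul_assoc, ← mul_assoc, ← ENNReal.ofReal_mul (by positivity),
            ← ENNReal.ofReal_mul (by positivity)]
      _ ≤ _ := by gcongr; exact le_max_right _ _
  · refine (hwle x r).trans_lt (ENNReal.mul_lt_top ENNReal.ofReal_lt_top ?_)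
    exact (hup x (hclosure x hx) r hr).trans_lt ENNReal.ofReal_lt_top
end
end
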